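/- L⁴ estimate for the I-operator at time 0: let 0 < s < 1, N ≥ 1, and u₀ ∈ H^s(T²). Then ‖Iu₀‖⁴_{L⁴(T²)} ≲ max(N^{2−4s}, 1) ‖u₀‖⁴_{H^s(T²)} ≲ N^{2(1−s)} ‖u₀‖⁴_{H^s(T²)}, with implied constants independent of N and u₀. -/

import Mathlib

open MeasureTheory Real ENNReal

noncomputable section

/-- The two-dimensional torus `ℝ²/ℤ²`. -/
abbrev T2 := AddCircle (1 : ℝ) × AddCircle (1 : ℝ)

/-- The character `e_n(x) = e^{2πi n·x}` on the torus. -/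
def fChar (n : ℤ × ℤ) : T2 → ℂ := fun x => fourier n.1 x.1 * fourier n.2 x.2

/-- The Fourier coefficient `f̂(n) = ∫_{T²} f(x) e^{-2πi n·x} dx`. -/
def fCoeff (f : T2 → ℂ) (n : ℤ × ℤ) : ℂ := ∫ x : T2, fChar (-n) x * f x

/-- Euclidean magnitude `|n|` of a frequency `n ∈ ℤ²`. -/
def fAbs (n : ℤ × ℤ) : ℝ := Real.sqrt ((n.1 : ℝ) ^ 2 + (n.2 : ℝ) ^ 2)

/-- The Japanese bracket `⟨n⟩ = (1+|n|²)^{1/2}` of a frequency. -/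
def jap (n : ℤ × ℤ) : ℝ := Real.sqrt (1 + ((n.1 : ℝ) ^ 2 + (n.2 : ℝ) ^ 2))

/-- The Japanese bracket `⟨x⟩` of a real number. -/
def japR (x : ℝ) : ℝ := Real.sqrt (1 + x ^ 2)

/-- The square of the Sobolev `H^s(T²)` norm: `Σ_n ⟨n⟩^{2s} |f̂(n)|²` (valued in `ℝ≥0∞`). -/
def sobSq (s : ℝ) (f : T2 → ℂ) : ℝ≥0∞ :=
  ∑' n : ℤ × ℤ, ENNReal.ofReal (jap n ^ (2 * s) * ‖fCoeff f n‖ ^ 2)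

/-- Membership in the Sobolev space `H^s(T²)`. -/
def MemHs (s : ℝ) (f : T2 → ℂ) : Prop := sobSq s f < ⊤

/-- The Sobolev `H^s(T²)` norm (valued in `ℝ≥0∞`). -/
def sobNorm (s : ℝ) (f : T2 → ℂ) : ℝ≥0∞ := sobSq s f ^ (1 / 2 : ℝ)

/-- A function is real-valued. -/
def RealData (f : T2 → ℂ) : Prop := ∀ x, (f x).im = 0

/-- The Fourier multiplier operator with symbol `σ`. -/
def mulOp (σ : ℤ × ℤ → ℂ) (f : T2 → ℂ) : T2 → ℂ :=
  fun x => ∑' n : ℤ × ℤ, σ n * fCoeff f n * fChar n x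

/-- The multiplier `⟨D⟩^α` with symbol `⟨n⟩^α`. -/
def DPow (α : ℝ) (f : T2 → ℂ) : T2 → ℂ := mulOp (fun n => ((jap n ^ α : ℝ) : ℂ)) f

/-- A smooth, radial, nonincreasing cut-off `η` with `0 ≤ η ≤ 1`, `η = 1` on `|ξ| ≤ 1` and
`η(ξ) = |ξ|^{-(1-s)}` for `|ξ| ≥ 2`. -/
structure EtaFun (s : ℝ) where
  eta : ℝ × ℝ → ℝ
  smooth : ContDiff ℝ (⊤ : ℕ∞) eta
  radial : ∀ x y : ℝ × ℝ, Real.sqrt (x.1 ^ 2 + x.2 ^ 2) = Real.sqrt (y.1 ^ 2 + y.2 ^ 2) →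
    eta x = eta y
  decreasing : ∀ x y : ℝ × ℝ, Real.sqrt (x.1 ^ 2 + x.2 ^ 2) ≤ Real.sqrt (y.1 ^ 2 + y.2 ^ 2) →
    eta y ≤ eta x
  nonneg : ∀ x, 0 ≤ eta x
  le_one : ∀ x, eta x ≤ 1
  eq_one : ∀ x : ℝ × ℝ, Real.sqrt (x.1 ^ 2 + x.2 ^ 2) ≤ 1 → eta x = 1
  eq_pow : ∀ x : ℝ × ℝ, 2 ≤ Real.sqrt (x.1 ^ 2 + x.2 ^ 2) →
    eta x = Real.sqrt (x.1 ^ 2 + x.2 ^ 2) ^ (-(1 - s))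

/-- The symbol `m(n) = η(n/N)` of the operator `I`. -/
def mSymb {s : ℝ} (θ : EtaFun s) (N : ℝ) (n : ℤ × ℤ) : ℝ :=
  θ.eta ((n.1 : ℝ) / N, (n.2 : ℝ) / N)

/-- The I-operator: Fourier multiplier with symbol `m(n) = η(n/N)`. -/
def Iop {s : ℝ} (θ : EtaFun s) (N : ℝ) (f : T2 → ℂ) : T2 → ℂ :=
  mulOp (fun n => ((mSymb θ N n : ℝ) : ℂ)) f

/-- The operator `⟨D⟩^α I`, a multiplier with symbol `⟨n⟩^α m(n)`. -/
def IDop {s : ℝ} (θ : EtaFun s) (N α : ℝ) (f : T2 → ℂ) : T2 → ℂ :=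
  mulOp (fun n => ((jap n ^ α * mSymb θ N n : ℝ) : ℂ)) f

/-- The operator `P_{≳N} ⟨D⟩^α I`, where `P_{≳N}` projects onto frequencies `|n| > 128N`. -/
def PIDop {s : ℝ} (θ : EtaFun s) (N α : ℝ) (f : T2 → ℂ) : T2 → ℂ :=
  mulOp (fun n => if 128 * N < fAbs n then ((jap n ^ α * mSymb θ N n : ℝ) : ℂ) else 0) f

/-- `‖∇ I f‖²_{L²}` computed on the Fourier side via Plancherel:
`Σ_n 4π²|n|² m²(n) |f̂(n)|²`. -/
def gradIL2Sq {s : ℝ} (θ : EtaFun s) (N : ℝ) (f : T2 → ℂ) : ℝ≥0∞ :=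
  ∑' n : ℤ × ℤ, ENNReal.ofReal
    (4 * π ^ 2 * ((n.1 : ℝ) ^ 2 + (n.2 : ℝ) ^ 2) * mSymb θ N n ^ 2 * ‖fCoeff f n‖ ^ 2)

/-- `‖I f‖²_{L²}` computed on the Fourier side via Plancherel: `Σ_n m²(n)|f̂(n)|²`. -/
def IL2Sq {s : ℝ} (θ : EtaFun s) (N : ℝ) (f : T2 → ℂ) : ℝ≥0∞ :=
  ∑' n : ℤ × ℤ, ENNReal.ofReal (mSymb θ N n ^ 2 * ‖fCoeff f n‖ ^ 2)

/-- The mollified energy `E(Iu) = ½‖∂_t Iu‖²_{L²} + ½‖∇Iu‖²_{L²} + ¼‖Iu‖⁴_{L⁴}`,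
where `f = u(t)` and `g = ∂_t u(t)`. -/
def molE {s : ℝ} (θ : EtaFun s) (N : ℝ) (f g : T2 → ℂ) : ℝ≥0∞ :=
  (1 / 2 : ℝ≥0∞) * (eLpNorm (Iop θ N g) 2 volume) ^ 2
    + (1 / 2 : ℝ≥0∞) * gradIL2Sq θ N f
    + (1 / 4 : ℝ≥0∞) * (eLpNorm (Iop θ N f) 4 volume) ^ 4

/-- The temporal frequency `2π|n|` of the wave mode `n`. -/
def wfreq (n : ℤ × ℤ) : ℝ := 2 * π * fAbs n

/-- `cos(t D)` at mode `n`. -/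
def cosK (n : ℤ × ℤ) (t : ℝ) : ℝ := Real.cos (wfreq n * t)

/-- `sin(t D)/D` at mode `n` (equal to `t` at the zero mode). -/
def sincK (n : ℤ × ℤ) (t : ℝ) : ℝ :=
  if wfreq n = 0 then t else Real.sin (wfreq n * t) / wfreq n

/-- `u` (with time derivative `v`) solves `∂_tt u - Δ u = G` on `J` with data `(u₀,u₁)` at
time `a`, in the Duhamel (mild/distributional) sense, mode by mode. -/
def DuhamelSol (a : ℝ) (J : Set ℝ) (u v : ℝ → T2 → ℂ) (u₀ u₁ : T2 → ℂ)
    (G : ℝ → T2 → ℂ) : Prop :=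
  (∀ n : ℤ × ℤ, fCoeff (u a) n = fCoeff u₀ n ∧ fCoeff (v a) n = fCoeff u₁ n) ∧
  ∀ t ∈ J, ∀ n : ℤ × ℤ,
    fCoeff (u t) n = (cosK n (t - a) : ℂ) * fCoeff u₀ n + (sincK n (t - a) : ℂ) * fCoeff u₁ n
        + (∫ τ in a..t, (sincK n (t - τ) : ℂ) * fCoeff (G τ) n) ∧
    fCoeff (v t) n
      = ((-(wfreq n) * Real.sin (wfreq n * (t - a)) : ℝ) : ℂ) * fCoeff u₀ n
        + (cosK n (t - a) : ℂ) * fCoeff u₁ n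
        + (∫ τ in a..t, (cosK n (t - τ) : ℂ) * fCoeff (G τ) n)

/-- `u` (with time derivative `v`) solves the defocusing cubic wave equation
`∂_tt u - Δ u = -u³` on `J` with data `(u₀,u₁)` at time `a`. -/
def CubicSol (a : ℝ) (J : Set ℝ) (u v : ℝ → T2 → ℂ) (u₀ u₁ : T2 → ℂ) : Prop :=
  DuhamelSol a J u v u₀ u₁ (fun t x => -(u t x) ^ 3)

/-- The mixed norm `‖w‖_{L_t^q L_x^r(J)}`. -/
def mixNorm (q r : ℝ≥0∞) (J : Set ℝ) (w : ℝ → T2 → ℂ) : ℝ≥0∞ :=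
  eLpNorm (fun t => (eLpNorm (w t) r volume).toReal) q (volume.restrict J)

/-- The dispersive norm
`Z_{m,s}(J,(u,v)) = ‖(⟨D⟩^{1-m} I u, ⟨D⟩^{-m} I v)‖_{L_t^{3/m} L_x^{6/(3-4m)}(J)}`,
where `v = ∂_t u`. -/
def ZNorm {s : ℝ} (θ : EtaFun s) (N m : ℝ) (J : Set ℝ) (u v : ℝ → T2 → ℂ) : ℝ≥0∞ :=
  mixNorm (ENNReal.ofReal (3 / m)) (ENNReal.ofReal (6 / (3 - 4 * m))) J
    (fun t => IDop θ N (1 - m) (u t))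
  + mixNorm (ENNReal.ofReal (3 / m)) (ENNReal.ofReal (6 / (3 - 4 * m))) J
    (fun t => IDop θ N (-m) (v t))

/-- The free evolution (linear part) of the solution starting from time `a` with data
`(f,g)`: `u_l^J(t) = cos((t-a)D) f + (sin((t-a)D)/D) g`. -/
def linPart (a : ℝ) (f g : T2 → ℂ) (t : ℝ) : T2 → ℂ :=
  fun x => ∑' n : ℤ × ℤ,
    ((cosK n (t - a) : ℂ) * fCoeff f n + (sincK n (t - a) : ℂ) * fCoeff g n) * fChar n x

/-- The time derivative of the free evolution starting from time `a` with data `(f,g)`. -/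
def linPartDt (a : ℝ) (f g : T2 → ℂ) (t : ℝ) : T2 → ℂ :=
  fun x => ∑' n : ℤ × ℤ,
    (((-(wfreq n) * Real.sin (wfreq n * (t - a)) : ℝ) : ℂ) * fCoeff f n
      + (cosK n (t - a) : ℂ) * fCoeff g n) * fChar n x

/-- The quantity `X_k` of Proposition `EstLinNonlin`:
the max of four high-frequency mixed space-time norms of `(w, ∂_t w)`. -/
def XNorm {s : ℝ} (θ : EtaFun s) (N : ℝ) (J : Set ℝ) (w dw : ℝ → T2 → ℂ) : ℝ≥0∞ :=
  max
    (max (mixNorm 8 4 J (fun t => PIDop θ N (1 - 3 / 8) (w t)))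
      (mixNorm 8 4 J (fun t => PIDop θ N (-(3 / 8)) (dw t))))
    (max (mixNorm 12 3 J (fun t => PIDop θ N (1 - 1 / 4) (w t)))
      (mixNorm 12 3 J (fun t => PIDop θ N (-(1 / 4)) (dw t))))

/-- The quantity `α` of Section 7.2 (with an arbitrarily small fixed `δ > 0`):
`max(|J|N^{2(1-s)+δ}/N, |J|^{1/2}N^{2(1-s)}/N^{3/2}, |J|^{7/12}N^{3(1-s)/2}/N^{3/4},
|J|^{1/2}N^{2(1-s)}⟨|J|N^{1-s}⟩^{1/8}/N^{3/2})`. -/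
def alphaVal (s δ N L : ℝ) : ℝ :=
  max (max (L * N ^ (2 * (1 - s) + δ) / N) (L ^ ((1:ℝ) / 2) * N ^ (2 * (1 - s)) / N ^ ((3:ℝ) / 2)))
    (max (L ^ ((7:ℝ) / 12) * N ^ (3 * (1 - s) / 2) / N ^ ((3:ℝ) / 4))
      (L ^ ((1:ℝ) / 2) * N ^ (2 * (1 - s)) * japR (L * N ^ (1 - s)) ^ ((1:ℝ) / 8) / N ^ ((3:ℝ) / 2)))

/-- Smoothness of a function on the torus: it lifts to a smooth function on `ℝ²`. -/
def SmoothT2 (f : T2 → ℂ) : Prop :=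
  ∃ F : ℝ × ℝ → ℂ, ContDiff ℝ (⊤ : ℕ∞) F ∧ ∀ x y : ℝ, f (↑x, ↑y) = F (x, y)

lemma integral_fourier_ite (n : ℤ) :
    ∫ x : AddCircle (1 : ℝ), fourier n x = if n = 0 then 1 else 0 := by
  split_ifs with h
  · subst h
    simp [measureReal_def, AddCircle.measure_univ]
  · exact integral_eq_zero_of_add_right_eq_neg (fourier_add_half_inv_index h one_pos)

lemma integral_fChar (n : ℤ × ℤ) : ∫ x : T2, fChar n x = if n = 0 then 1 else 0 := by
  unfold fChar
  rw [Measure.volume_eq_prod,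
    integral_prod_mul (fun x : AddCircle (1 : ℝ) => fourier n.1 x)
      (fun x : AddCircle (1 : ℝ) => fourier n.2 x), integral_fourier_ite, integral_fourier_ite]
  simp only [Prod.ext_iff, Prod.fst_zero, Prod.snd_zero]
  split_ifs <;> simp_all

lemma norm_fChar (n : ℤ × ℤ) (x : T2) : ‖fChar n x‖ = 1 := by
  rw [fChar, norm_mul, fourier_apply, fourier_apply, Circle.norm_coe, Circle.norm_coe, mul_one]

lemma fChar_add (m n : ℤ × ℤ) (x : T2) : fChar (m + n) x = fChar m x * fChar n x := by
  simp only [fChar, Prod.fst_add, Prod.snd_add, fourier_add]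
  ring

lemma fChar_sub (m n : ℤ × ℤ) (x : T2) :
    fChar (m - n) x = fChar m x * (starRingEnd ℂ) (fChar n x) := by
  rw [sub_eq_add_neg, fChar_add]
  simp [fChar]

lemma continuous_fChar (n : ℤ × ℤ) : Continuous (fChar n) := by
  unfold fChar
  fun_prop

lemma continuous_tsum_fChar {c : ℤ × ℤ → ℂ} (hc : Summable fun n => ‖c n‖) :
    Continuous fun x => ∑' n, c n * fChar n x :=
  continuous_tsum (fun n => continuous_const.mul (continuous_fChar n)) hc
    fun n x => by rw [norm_mul, norm_fChar, mul_one]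

lemma summable_mul_fChar {c : ℤ × ℤ → ℂ} (hc : Summable fun n => ‖c n‖) (x : T2) :
    Summable fun n => ‖c n * fChar n x‖ := by
  simpa [norm_fChar] using hc

/-- Parseval's identity for absolutely convergent Fourier series. -/
lemma lintegral_enorm_tsum_fChar_sq {c : ℤ × ℤ → ℂ} (hc : Summable fun n => ‖c n‖) :
    ∫⁻ x : T2, ‖∑' n, c n * fChar n x‖ₑ ^ 2 = ∑' n, ‖c n‖ₑ ^ 2 := by
  set g : T2 → ℂ := fun x => ∑' n, c n * fChar n x with hg
  have hgc : Continuous g := continuous_tsum_fChar hc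
  let F : (ℤ × ℤ) × (ℤ × ℤ) → T2 → ℂ :=
    fun p x => c p.1 * (starRingEnd ℂ) (c p.2) * fChar (p.1 - p.2) x
  have hFc (p) : Continuous (F p) := continuous_const.mul (continuous_fChar _)
  have hFi (p) : Integrable (F p) volume :=
    (hFc p).integrable_of_hasCompactSupport (HasCompactSupport.of_compactSpace _)
  have hFn : ∀ p x, ‖F p x‖ = ‖c p.1‖ * ‖c p.2‖ := fun p x => by
    simp [F, norm_fChar]
  have hvol : (volume : Measure T2).real Set.univ = 1 := by
    rw [Measure.volume_eq_prod, measureReal_def, ← Set.univ_prod_univ, Measure.prod_prod]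
    simp [AddCircle.measure_univ]
  have hs : Summable fun p => ∫ x : T2, ‖F p x‖ := by
    simp only [hFn, integral_const, hvol, one_smul]
    exact hc.mul_of_nonneg hc (fun _ => norm_nonneg _) (fun _ => norm_nonneg _)
  have h1 := hasSum_integral_of_summable_integral_norm hFi hs
  have hpt : ∀ x, ∑' p, F p x = ((‖g x‖ ^ 2 : ℝ) : ℂ) := fun x => by
    have hx := summable_mul_fChar hc x
    have hx' : Summable fun n => ‖(starRingEnd ℂ) (c n * fChar n x)‖ := by simpa using hx
    have : (starRingEnd ℂ) (g x) = ∑' n, (starRingEnd ℂ) (c n * fChar n x) := Complex.conj_tsum _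
    rw [Complex.ofReal_pow, ← Complex.mul_conj', this, hg,
      tsum_mul_tsum_of_summable_norm hx hx']
    refine tsum_congr fun p => ?_
    simp only [F, fChar_sub, map_mul]
    ring
  have hint : ∀ p, ∫ x, F p x = if p.1 = p.2 then ((‖c p.1‖ ^ 2 : ℝ) : ℂ) else 0 := fun p => by
    simp only [F]
    rw [integral_const_mul, integral_fChar]
    simp only [sub_eq_zero]
    split_ifs with h
    · rw [← h, Complex.mul_conj', mul_one, Complex.ofReal_pow]
    · simp
  simp only [hpt, hint] at h1
  rw [integral_complex_ofReal] at h1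
  have hinj : Function.Injective fun n : ℤ × ℤ => (n, n) := fun a b h => (Prod.ext_iff.1 h).1
  rw [← hinj.hasSum_iff] at h1
  swap
  · rintro ⟨a, b⟩ hab
    have : a ≠ b := by
      rintro rfl
      exact hab ⟨a, rfl⟩
    simp [this]
  have h2 : HasSum (fun n => ‖c n‖ ^ 2) (∫ x, ‖g x‖ ^ 2) := by
    rw [← Complex.hasSum_ofReal]
    simpa [Function.comp_def] using h1
  have hgi : Integrable (fun x => ‖g x‖ ^ 2) (volume : Measure T2) :=
    (hgc.norm.pow 2).integrable_of_hasCompactSupport (HasCompactSupport.of_compactSpace _)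
  have he : ∀ z : ℂ, ‖z‖ₑ ^ 2 = ENNReal.ofReal (‖z‖ ^ 2) := fun z => by
    rw [ENNReal.ofReal_pow (norm_nonneg _), ofReal_norm]
  simp only [he]
  rw [← ofReal_integral_eq_lintegral_ofReal hgi (Filter.Eventually.of_forall fun x => by positivity),
    ← h2.tsum_eq, ENNReal.ofReal_tsum_of_nonneg (fun _ => by positivity) h2.summable]

/-- The fourth power of the `L⁴` norm of an absolutely convergent Fourier series is bounded by
the square of the `ℓ²` norm of the self-convolution of its coefficients. -/
lemma eLpNorm_four_tsum_fChar_le {a : ℤ × ℤ → ℂ} (ha : Summable fun n => ‖a n‖) :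
    (eLpNorm (fun x : T2 => ∑' n, a n * fChar n x) 4 volume) ^ 4
      ≤ ∑' k, (∑' n, ‖a n‖ₑ * ‖a (k - n)‖ₑ) ^ 2 := by
  have h4 := eLpNorm_nnreal_pow_eq_lintegral (μ := (volume : Measure T2))
    (f := fun x : T2 => ∑' n, a n * fChar n x) (p := 4) (by norm_num)
  have h4' : (eLpNorm (fun x : T2 => ∑' n, a n * fChar n x) 4 volume) ^ 4
      = ∫⁻ x : T2, ‖∑' n, a n * fChar n x‖ₑ ^ 4 := by
    have e : ((4 : NNReal) : ℝ) = ((4 : ℕ) : ℝ) := by norm_num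
    simp only [e, ENNReal.rpow_natCast] at h4
    simpa using h4
  let e : (ℤ × ℤ) × (ℤ × ℤ) ≃ (ℤ × ℤ) × (ℤ × ℤ) :=
    { toFun := fun p => (p.2, p.1 - p.2)
      invFun := fun p => (p.1 + p.2, p.1)
      left_inv := fun p => by simp
      right_inv := fun p => by simp }
  have hprod : Summable fun p : (ℤ × ℤ) × (ℤ × ℤ) => ‖a p.2 * a (p.1 - p.2)‖ := by
    have := ha.mul_of_nonneg ha (fun _ => norm_nonneg _) (fun _ => norm_nonneg _)
    simpa [e, Function.comp_def] using e.summable_iff.2 this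
  set c : ℤ × ℤ → ℂ := fun k => ∑' n, a n * a (k - n) with hcdef
  have hfib (k) : Summable fun n => ‖a n * a (k - n)‖ := hprod.prod_factor k
  have hc : Summable fun k => ‖c k‖ :=
    Summable.of_nonneg_of_le (fun _ => norm_nonneg _)
      (fun k => norm_tsum_le_tsum_norm (hfib k)) hprod.prod
  have hsq : ∀ x : T2, (∑' n, a n * fChar n x) ^ 2 = ∑' k, c k * fChar k x := fun x => by
    have hx := summable_mul_fChar ha x
    rw [sq, tsum_mul_tsum_of_summable_norm hx hx, ← e.tsum_eq]
    have hterm : ∀ p : (ℤ × ℤ) × (ℤ × ℤ),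
        a (e p).1 * fChar (e p).1 x * (a (e p).2 * fChar (e p).2 x)
          = a p.2 * a (p.1 - p.2) * fChar p.1 x := fun p => by
      have : fChar p.1 x = fChar p.2 x * fChar (p.1 - p.2) x := by
        rw [← fChar_add, add_sub_cancel]
      simp only [e, Equiv.coe_fn_mk, this]
      ring
    simp only [hterm]
    rw [Summable.tsum_prod]
    · simp only [hcdef, tsum_mul_right]
    · refine Summable.of_norm ?_
      simpa [norm_fChar] using hprod
  calc (eLpNorm (fun x : T2 => ∑' n, a n * fChar n x) 4 volume) ^ 4
      = ∫⁻ x : T2, ‖∑' k, c k * fChar k x‖ₑ ^ 2 := by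
        rw [h4']
        refine lintegral_congr fun x => ?_
        rw [← hsq, enorm_pow, ← pow_mul]
    _ = ∑' k, ‖c k‖ₑ ^ 2 := lintegral_enorm_tsum_fChar_sq hc
    _ ≤ _ := by
        gcongr with k
        refine (enorm_tsum_le_tsum_enorm).trans_eq ?_
        simp only [enorm_mul]

/-- The supremum norm of a frequency, as a natural number. -/
def supAbs (n : ℤ × ℤ) : ℕ := max n.1.natAbs n.2.natAbs

lemma one_le_jap (n : ℤ × ℤ) : 1 ≤ jap n :=
  Real.one_le_sqrt.2 (by nlinarith [sq_nonneg (n.1 : ℝ), sq_nonneg (n.2 : ℝ)])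

lemma jap_pos (n : ℤ × ℤ) : 0 < jap n := one_pos.trans_le (one_le_jap n)

lemma sum_range_inv_sqrt_le (R : ℕ) :
    ∑ j ∈ Finset.range R, (Real.sqrt (1 + j))⁻¹ ≤ 2 * Real.sqrt R := by
  induction R with
  | zero => simp
  | succ R ih =>
    rw [Finset.sum_range_succ]
    have h0 : (0 : ℝ) ≤ R := Nat.cast_nonneg R
    set x := Real.sqrt R
    have hx : 0 ≤ x := Real.sqrt_nonneg _
    have hx2 : x ^ 2 = R := Real.sq_sqrt h0
    have e : ((R + 1 : ℕ) : ℝ) = 1 + R := by push_cast; ring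
    rw [e]
    set y := Real.sqrt (1 + R)
    have hy : 0 < y := Real.sqrt_pos.2 (by positivity)
    have hy2 : y ^ 2 = 1 + R := Real.sq_sqrt (by positivity)
    have : y⁻¹ ≤ 2 * y - 2 * x := by
      rw [inv_le_iff_one_le_mul₀ hy]
      nlinarith [sq_nonneg (y - x)]
    linarith

lemma sum_Icc_inv_sqrt_natAbs_le (R : ℕ) :
    ∑ j ∈ Finset.Icc (-(R : ℤ)) R, (Real.sqrt (1 + j.natAbs))⁻¹ ≤ 4 * Real.sqrt (R + 1) := by
  have hsub : Finset.Icc (-(R : ℤ)) R ⊆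
      (Finset.range (R + 1)).image (fun j : ℕ => (j : ℤ))
        ∪ (Finset.range (R + 1)).image (fun j : ℕ => -(j : ℤ)) := by
    intro j hj
    rw [Finset.mem_Icc] at hj
    simp only [Finset.mem_union, Finset.mem_image, Finset.mem_range]
    rcases le_total 0 j with h | h
    · exact Or.inl ⟨j.natAbs, by omega, by omega⟩
    · exact Or.inr ⟨j.natAbs, by omega, by omega⟩
  have hb := sum_range_inv_sqrt_le (R + 1)
  push_cast at hb
  have hnn : ∀ j : ℤ, 0 ≤ (Real.sqrt (1 + j.natAbs))⁻¹ := fun j => by positivity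
  calc ∑ j ∈ Finset.Icc (-(R : ℤ)) R, (Real.sqrt (1 + j.natAbs))⁻¹
      ≤ _ := Finset.sum_le_sum_of_subset_of_nonneg hsub fun j _ _ => hnn j
    _ ≤ ∑ j ∈ (Finset.range (R + 1)).image (fun j : ℕ => (j : ℤ)), (Real.sqrt (1 + j.natAbs))⁻¹
        + ∑ j ∈ (Finset.range (R + 1)).image (fun j : ℕ => -(j : ℤ)),
            (Real.sqrt (1 + j.natAbs))⁻¹ := by
        rw [← Finset.sum_union_inter]
        exact le_add_of_nonneg_right (Finset.sum_nonneg fun j _ => hnn j)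
    _ ≤ 2 * Real.sqrt (R + 1) + 2 * Real.sqrt (R + 1) := by
        rw [Finset.sum_image (by intro a _ b _ h; simpa using h),
          Finset.sum_image (by intro a _ b _ h; simpa using h)]
        simpa using add_le_add hb hb
    _ = _ := by ring

lemma inv_jap_le (n : ℤ × ℤ) :
    (jap n)⁻¹ ≤ 2 * ((Real.sqrt (1 + n.1.natAbs))⁻¹ * (Real.sqrt (1 + n.2.natAbs))⁻¹) := by
  rw [← mul_inv, ← Real.sqrt_mul (by positivity), ← div_eq_mul_inv, inv_eq_one_div,
    div_le_div_iff₀ (jap_pos n) (Real.sqrt_pos.2 (by positivity)), one_mul]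
  refine Real.sqrt_le_iff.2 ⟨by linarith [jap_pos n], ?_⟩
  rw [mul_pow, jap, Real.sq_sqrt (by positivity)]
  simp only [Nat.cast_natAbs, Int.cast_abs]
  nlinarith [sq_abs (n.1 : ℝ), sq_abs (n.2 : ℝ), sq_nonneg (|(n.1 : ℝ)| - |(n.2 : ℝ)|),
    sq_nonneg (|(n.1 : ℝ)| - 1), sq_nonneg (|(n.2 : ℝ)| - 1)]

lemma supAbs_add_one_le (m : ℤ × ℤ) : (supAbs m : ℝ) + 1 ≤ 2 * jap m := by
  have h1 : (supAbs m : ℝ) ≤ jap m := by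
    rw [supAbs, Nat.cast_max]
    refine max_le ?_ ?_ <;>
    · rw [Nat.cast_natAbs, Int.cast_abs]
      refine Real.abs_le_sqrt ?_
      nlinarith [sq_nonneg (m.1 : ℝ), sq_nonneg (m.2 : ℝ)]
  linarith [one_le_jap m]

/-- The sum of `⟨n⟩⁻¹` over a square of side comparable to `⟨m⟩` is `O(⟨m⟩)`. -/
lemma tsum_inv_jap_le (m : ℤ × ℤ) :
    ∑' n, (if supAbs n ≤ supAbs m then (ENNReal.ofReal (jap n))⁻¹ else 0)
      ≤ 64 * ENNReal.ofReal (jap m) := by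
  set R := supAbs m with hR
  set S : Finset (ℤ × ℤ) := Finset.Icc (-(R : ℤ)) R ×ˢ Finset.Icc (-(R : ℤ)) R with hS
  have hmem : ∀ n, supAbs n ≤ R ↔ n ∈ S := fun n => by
    simp only [hS, supAbs, Finset.mem_product, Finset.mem_Icc]
    omega
  have hreal : ∑ n ∈ S, (jap n)⁻¹ ≤ 64 * jap m := by
    calc ∑ n ∈ S, (jap n)⁻¹
        ≤ ∑ n ∈ S, 2 * ((Real.sqrt (1 + n.1.natAbs))⁻¹ * (Real.sqrt (1 + n.2.natAbs))⁻¹) :=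
          Finset.sum_le_sum fun n _ => inv_jap_le n
      _ = 2 * (∑ j ∈ Finset.Icc (-(R : ℤ)) R, (Real.sqrt (1 + j.natAbs))⁻¹) ^ 2 := by
          rw [← Finset.mul_sum, hS, Finset.sum_product, sq, Finset.sum_mul_sum]
      _ ≤ 2 * (4 * Real.sqrt (R + 1)) ^ 2 := by
          gcongr
          exact sum_Icc_inv_sqrt_natAbs_le R
      _ ≤ 64 * jap m := by
          rw [mul_pow, Real.sq_sqrt (by positivity)]
          linarith [supAbs_add_one_le m]
  calc ∑' n, (if supAbs n ≤ R then (ENNReal.ofReal (jap n))⁻¹ else 0)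
      = ∑ n ∈ S, ENNReal.ofReal (jap n)⁻¹ := by
        rw [tsum_eq_sum (s := S) fun n hn => by rw [if_neg ((hmem n).not.2 hn)]]
        refine Finset.sum_congr rfl fun n hn => ?_
        rw [if_pos ((hmem n).2 hn), ENNReal.ofReal_inv_of_pos (jap_pos n)]
    _ = ENNReal.ofReal (∑ n ∈ S, (jap n)⁻¹) :=
        (ENNReal.ofReal_sum_of_nonneg fun n _ => (inv_pos.2 (jap_pos n)).le).symm
    _ ≤ ENNReal.ofReal (64 * jap m) := ENNReal.ofReal_le_ofReal hreal
    _ = _ := by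
        rw [ENNReal.ofReal_mul (by norm_num)]
        norm_num

/-- The Cauchy–Schwarz inequality for series of extended nonnegative reals. -/
lemma ENNReal.tsum_mul_sq_le {ι : Type*} (f g : ι → ℝ≥0∞) :
    (∑' i, f i * g i) ^ 2 ≤ (∑' i, f i ^ 2) * ∑' i, g i ^ 2 := by
  let _ : MeasurableSpace ι := ⊤
  have h := ENNReal.lintegral_mul_le_Lp_mul_Lq (Measure.count : Measure ι)
    Real.HolderConjugate.two_two (f := f) (g := g) measurable_from_top.aemeasurable
    measurable_from_top.aemeasurable
  simp only [lintegral_count, Pi.mul_apply, ENNReal.rpow_two] at h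
  have h2 := pow_le_pow_left' h 2
  have e : ∀ x : ℝ≥0∞, (x ^ (1 / 2 : ℝ)) ^ 2 = x := fun x => by
    rw [← ENNReal.rpow_natCast, ← ENNReal.rpow_mul]
    norm_num
  rwa [mul_pow, e, e] at h2

/-- The bilinear form of the endpoint Sobolev embedding `H^{1/2}(T²) ⊂ L⁴(T²)` on the Fourier
side. -/
lemma tsum_conv_sq_le (A : ℤ × ℤ → ℝ≥0∞) :
    ∑' k, (∑' n, A n * A (k - n)) ^ 2
      ≤ 256 * (∑' n, ENNReal.ofReal (jap n) * A n ^ 2) ^ 2 := by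
  set J : ℤ × ℤ → ℝ≥0∞ := fun n => ENNReal.ofReal (jap n) with hJ
  have hJ0 (n) : J n ≠ 0 := (ENNReal.ofReal_pos.2 (jap_pos n)).ne'
  have hJt (n) : J n ≠ ⊤ := ENNReal.ofReal_ne_top
  set B := ∑' n, J n * A n ^ 2 with hB
  let χ : ℤ × ℤ → ℤ × ℤ → ℝ≥0∞ := fun n m => if supAbs n ≤ supAbs m then 1 else 0
  have hχ (n m) : 1 ≤ χ n m + χ m n := by
    simp only [χ]
    rcases le_total (supAbs n) (supAbs m) with h | h <;> simp [h]
  have hhalf (k) : ∑' n, A n * A (k - n) ≤ 2 * ∑' n, χ n (k - n) * (A n * A (k - n)) := by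
    have hswap : ∑' n, χ (k - n) n * (A n * A (k - n))
        = ∑' n, χ n (k - n) * (A n * A (k - n)) := by
      rw [← (Equiv.subLeft k).tsum_eq]
      refine tsum_congr fun n => ?_
      have hkn : k - (k - n) = n := sub_sub_cancel k n
      simp only [Equiv.subLeft_apply, hkn, mul_comm (A (k - n))]
    calc ∑' n, A n * A (k - n)
        ≤ ∑' n, (χ n (k - n) * (A n * A (k - n)) + χ (k - n) n * (A n * A (k - n))) := by
          gcongr with n
          rw [← add_mul]
          exact le_mul_of_one_le_left' (hχ _ _)
      _ = _ := by rw [ENNReal.tsum_add, hswap, two_mul]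
  have hcs (k) : (∑' n, χ n (k - n) * (A n * A (k - n))) ^ 2
      ≤ B * ∑' n, χ n (k - n) * (J n)⁻¹ * A (k - n) ^ 2 := by
    have hr (n) : (J n ^ (1 / 2 : ℝ)) ^ 2 = J n := by
      rw [← ENNReal.rpow_natCast, ← ENNReal.rpow_mul]
      norm_num
    have h0 (n) : J n ^ (1 / 2 : ℝ) ≠ 0 := by simp [hJ0]
    have ht (n) : J n ^ (1 / 2 : ℝ) ≠ ⊤ := by simp [hJt]
    have hx2 (n m) : χ n m ^ 2 = χ n m := by simp [χ]
    have h := ENNReal.tsum_mul_sq_le (fun n => J n ^ (1 / 2 : ℝ) * A n)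
      (fun n => χ n (k - n) * (J n ^ (1 / 2 : ℝ))⁻¹ * A (k - n))
    simp only [mul_pow, hr, hx2, ← ENNReal.inv_pow] at h
    refine le_of_eq_of_le ?_ h
    congr 1
    refine tsum_congr fun n => ?_
    calc χ n (k - n) * (A n * A (k - n))
        = (J n ^ (1 / 2 : ℝ) * (J n ^ (1 / 2 : ℝ))⁻¹) * (χ n (k - n) * (A n * A (k - n))) := by
          rw [ENNReal.mul_inv_cancel (h0 n) (ht n), one_mul]
      _ = _ := by ring
  have hshift (n) : ∑' k, χ n (k - n) * (J n)⁻¹ * A (k - n) ^ 2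
      = ∑' m, χ n m * (J n)⁻¹ * A m ^ 2 :=
    (Equiv.subRight n).tsum_eq fun m => χ n m * (J n)⁻¹ * A m ^ 2
  have hcount (m) : ∑' n, χ n m * (J n)⁻¹ ≤ 64 * J m := by
    refine le_of_eq_of_le (tsum_congr fun n => ?_) (tsum_inv_jap_le m)
    simp [χ, hJ]
  calc ∑' k, (∑' n, A n * A (k - n)) ^ 2
      ≤ ∑' k, 4 * (B * ∑' n, χ n (k - n) * (J n)⁻¹ * A (k - n) ^ 2) := by
        gcongr with k
        calc (∑' n, A n * A (k - n)) ^ 2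
            ≤ (2 * ∑' n, χ n (k - n) * (A n * A (k - n))) ^ 2 := by gcongr; exact hhalf k
          _ = 4 * (∑' n, χ n (k - n) * (A n * A (k - n))) ^ 2 := by rw [mul_pow]; norm_num
          _ ≤ _ := by gcongr; exact hcs k
    _ = 4 * (B * ∑' m, (∑' n, χ n m * (J n)⁻¹) * A m ^ 2) := by
        rw [ENNReal.tsum_mul_left, ENNReal.tsum_mul_left, ENNReal.tsum_comm]
        simp only [hshift]
        rw [ENNReal.tsum_comm]
        simp only [ENNReal.tsum_mul_right]
    _ ≤ 4 * (B * ∑' m, 64 * J m * A m ^ 2) := by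
        gcongr with m
        exact hcount m
    _ = 256 * B ^ 2 := by
        simp only [mul_assoc, ENNReal.tsum_mul_left]
        rw [← hB]
        ring

lemma jap_le_one_add_fAbs (n : ℤ × ℤ) : jap n ≤ 1 + fAbs n := by
  have h : 0 ≤ fAbs n := Real.sqrt_nonneg _
  refine Real.sqrt_le_iff.2 ⟨by positivity, ?_⟩
  have : fAbs n ^ 2 = (n.1 : ℝ) ^ 2 + (n.2 : ℝ) ^ 2 := Real.sq_sqrt (by positivity)
  nlinarith

lemma sqrt_div_eq_fAbs_div {N : ℝ} (hN : 0 < N) (n : ℤ × ℤ) :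
    Real.sqrt (((n.1 : ℝ) / N) ^ 2 + ((n.2 : ℝ) / N) ^ 2) = fAbs n / N := by
  rw [fAbs, div_pow, div_pow, ← add_div, Real.sqrt_div (by positivity), Real.sqrt_sq hN.le]

/-- The symbol `⟨n⟩^{1/2-s} m(n)` of `I : H^s → H^{1/2}` is `O(max(N^{1/2-s}, 1))`. -/
lemma jap_mul_mSymb_sq_le {s : ℝ} (hs0 : 0 < s) (hs1 : s < 1) (θ : EtaFun s) {N : ℝ}
    (hN : 1 ≤ N) (n : ℤ × ℤ) :
    jap n * mSymb θ N n ^ 2 ≤ 3 * max (N ^ (1 - 2 * s)) 1 * jap n ^ (2 * s) := by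
  have hN0 : 0 < N := one_pos.trans_le hN
  have hJ := one_le_jap n
  have hJ0 := jap_pos n
  have hm0 : 0 ≤ mSymb θ N n := θ.nonneg _
  have hm1 : mSymb θ N n ≤ 1 := θ.le_one _
  have hmsq : mSymb θ N n ^ 2 ≤ 1 := pow_le_one₀ hm0 hm1
  have hM1 : 1 ≤ max (N ^ (1 - 2 * s)) 1 := le_max_right _ _
  rcases le_or_gt (1 / 2) s with hs | hs
  · have h1 : jap n ≤ jap n ^ (2 * s) := Real.self_le_rpow_of_one_le hJ (by linarith)
    nlinarith [mul_nonneg hJ0.le (sub_nonneg.2 hmsq),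
      mul_nonneg (sub_nonneg.2 hM1) (hJ0.le.trans h1)]
  have hsplit : jap n = jap n ^ (1 - 2 * s) * jap n ^ (2 * s) := by
    rw [← Real.rpow_add hJ0]
    simp
  suffices h : jap n ^ (1 - 2 * s) * mSymb θ N n ^ 2 ≤ 3 * N ^ (1 - 2 * s) by
    calc jap n * mSymb θ N n ^ 2
        = (jap n ^ (1 - 2 * s) * mSymb θ N n ^ 2) * jap n ^ (2 * s) := by
          conv_lhs => rw [hsplit]
          ring
      _ ≤ (3 * N ^ (1 - 2 * s)) * jap n ^ (2 * s) := by gcongr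
      _ ≤ _ := by
          gcongr
          exact le_max_left _ _
  have he0 : 0 ≤ 1 - 2 * s := by linarith
  have h3 : (3 : ℝ) ^ (1 - 2 * s) ≤ 3 :=
    Real.rpow_le_self_of_one_le (by norm_num) (by linarith)
  rcases lt_or_ge (fAbs n / N) 2 with hr | hr
  · rw [div_lt_iff₀ hN0] at hr
    have hj : jap n ≤ 3 * N := by linarith [jap_le_one_add_fAbs n]
    calc jap n ^ (1 - 2 * s) * mSymb θ N n ^ 2
        ≤ (3 * N) ^ (1 - 2 * s) * 1 := by gcongr
      _ = 3 ^ (1 - 2 * s) * N ^ (1 - 2 * s) := by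
          rw [mul_one, Real.mul_rpow (by norm_num) hN0.le]
      _ ≤ _ := by gcongr
  · set r := fAbs n / N with hrdef
    have hr0 : 0 < r := by linarith
    have hrN : fAbs n = r * N := by rw [hrdef]; field_simp
    have hj : jap n ≤ 3 * N * r := by nlinarith [jap_le_one_add_fAbs n]
    have hmr : mSymb θ N n = r ^ (-(1 - s)) := by
      have h := θ.eq_pow ((n.1 : ℝ) / N, (n.2 : ℝ) / N)
      simp only [sqrt_div_eq_fAbs_div hN0] at h
      exact h hr
    have hm2 : mSymb θ N n ^ 2 ≤ r ^ (-(1 - 2 * s)) := by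
      rw [hmr, ← Real.rpow_natCast, ← Real.rpow_mul hr0.le]
      refine Real.rpow_le_rpow_of_exponent_le (by linarith) ?_
      push_cast
      linarith
    calc jap n ^ (1 - 2 * s) * mSymb θ N n ^ 2
        ≤ (3 * N * r) ^ (1 - 2 * s) * r ^ (-(1 - 2 * s)) := by gcongr
      _ = 3 ^ (1 - 2 * s) * N ^ (1 - 2 * s) := by
          rw [Real.mul_rpow (by positivity) hr0.le, Real.mul_rpow (by norm_num) hN0.le, mul_assoc,
            ← Real.rpow_add hr0, add_neg_cancel, Real.rpow_zero, mul_one]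
      _ ≤ _ := by gcongr

/-- The series defining `I f` converges absolutely, or it converges nowhere and `I f = 0`. -/
lemma eLpNorm_Iop_four_le {s : ℝ} (θ : EtaFun s) (N : ℝ) (f : T2 → ℂ) :
    (eLpNorm (Iop θ N f) 4 volume) ^ 4
      ≤ ∑' k, (∑' n, ‖(mSymb θ N n : ℂ) * fCoeff f n‖ₑ
          * ‖(mSymb θ N (k - n) : ℂ) * fCoeff f (k - n)‖ₑ) ^ 2 := by
  by_cases h : Summable fun n => ‖(mSymb θ N n : ℂ) * fCoeff f n‖
  · exact eLpNorm_four_tsum_fChar_le h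
  · have h0 : Iop θ N f = 0 := by
      funext x
      refine tsum_eq_zero_of_not_summable fun hx => h ?_
      simpa [norm_fChar] using hx.norm
    simp [h0]

lemma tsum_jap_mul_enorm_sq_le {s : ℝ} (hs0 : 0 < s) (hs1 : s < 1) (θ : EtaFun s) {N : ℝ}
    (hN : 1 ≤ N) (f : T2 → ℂ) :
    ∑' n, ENNReal.ofReal (jap n) * ‖(mSymb θ N n : ℂ) * fCoeff f n‖ₑ ^ 2
      ≤ ENNReal.ofReal (3 * max (N ^ (1 - 2 * s)) 1) * sobSq s f := by
  rw [sobSq, ← ENNReal.tsum_mul_left]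
  refine ENNReal.tsum_le_tsum fun n => ?_
  rw [← ofReal_norm, ← ENNReal.ofReal_pow (norm_nonneg _), ← ENNReal.ofReal_mul (jap_pos n).le,
    ← ENNReal.ofReal_mul (by positivity)]
  refine ENNReal.ofReal_le_ofReal ?_
  rw [norm_mul, mul_pow, Complex.norm_real, Real.norm_eq_abs, sq_abs]
  linarith [mul_le_mul_of_nonneg_right (jap_mul_mSymb_sq_le hs0 hs1 θ hN n)
    (sq_nonneg ‖fCoeff f n‖)]

/-- `L⁴` estimate for the I-operator at time `0`:
`‖Iu₀‖⁴_{L⁴} ≲ max(N^{2-4s},1) ‖u₀‖⁴_{H^s} ≲ N^{2(1-s)} ‖u₀‖⁴_{H^s}`,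
with implied constants independent of `N` and `u₀`. -/
theorem L4_bound_I
    (s : ℝ) (hs0 : 0 < s) (hs1 : s < 1) (θ : EtaFun s) :
    ∃ C : ℝ, 0 < C ∧
      ∀ N : ℝ, 1 ≤ N → ∀ u₀ : T2 → ℂ, MemHs s u₀ →
        (eLpNorm (Iop θ N u₀) 4 volume) ^ 4
            ≤ ENNReal.ofReal C * ENNReal.ofReal (max (N ^ (2 - 4 * s)) 1) * (sobSq s u₀) ^ 2 ∧
        (eLpNorm (Iop θ N u₀) 4 volume) ^ 4
            ≤ ENNReal.ofReal C * ENNReal.ofReal (N ^ (2 * (1 - s))) * (sobSq s u₀) ^ 2 := by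
  refine ⟨2304, by norm_num, fun N hN u₀ _ => ?_⟩
  have hN0 : 0 < N := one_pos.trans_le hN
  have hsq : (3 * max (N ^ (1 - 2 * s)) 1) ^ 2 = 9 * max (N ^ (2 - 4 * s)) 1 := by
    have hp : (N ^ (1 - 2 * s)) ^ 2 = N ^ (2 - 4 * s) := by
      rw [← Real.rpow_natCast, ← Real.rpow_mul hN0.le]
      congr 1
      push_cast
      ring
    rw [mul_pow, MonotoneOn.map_max (f := fun x : ℝ => x ^ 2) pow_left_monotoneOn
      (Set.mem_ofPred.2 (by positivity)) (Set.mem_ofPred.2 zero_le_one), hp]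
    norm_num
  have hmain : (eLpNorm (Iop θ N u₀) 4 volume) ^ 4
      ≤ ENNReal.ofReal 2304 * ENNReal.ofReal (max (N ^ (2 - 4 * s)) 1) * (sobSq s u₀) ^ 2 :=
    calc (eLpNorm (Iop θ N u₀) 4 volume) ^ 4
        ≤ _ := eLpNorm_Iop_four_le θ N u₀
      _ ≤ _ := tsum_conv_sq_le fun n => ‖(mSymb θ N n : ℂ) * fCoeff u₀ n‖ₑ
      _ ≤ 256 * (ENNReal.ofReal (3 * max (N ^ (1 - 2 * s)) 1) * sobSq s u₀) ^ 2 := by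
          gcongr
          exact tsum_jap_mul_enorm_sq_le hs0 hs1 θ hN u₀
      _ = _ := by
          rw [mul_pow, ← ENNReal.ofReal_pow (by positivity), hsq, ← mul_assoc,
            ← ENNReal.ofReal_mul (by norm_num), ← ENNReal.ofReal_ofNat 256,
            ← ENNReal.ofReal_mul (by norm_num), ← mul_assoc]
          norm_num
  refine ⟨hmain, hmain.trans ?_⟩
  gcongr
  exact max_le (Real.rpow_le_rpow_of_exponent_le hN (by linarith))
    (Real.one_le_rpow hN (by linarith))

end
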